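/- Suppose Assumption 1 holds, ‖A₀‖, ‖A₁‖ ≤ 1 (spectral norm), ‖b₀‖, ‖b₁‖ ≤ 1, Γ ⊆ [0, ζ], 0 < ξ ≤ 1 ≤ ζ, and there is γ̂ ≥ 0 with A(γ̂) ⪰ ξI. Suppose the coherence parameter δ := ‖A₀A(γ̂)⁻¹b₁ − A₁A(γ̂)⁻¹b₀‖ is positive. Then ν'(γ) ≤ −δ²ξ²/(4ζ³) for every γ in the interior of Γ; consequently, for every ε > 0 the set {γ ∈ interior(Γ) : |ν(γ)| ≤ ε/(2ζ)} is contained in an interval of length at most 4εζ²/(δ²ξ²). -/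

import Mathlib

open Matrix Set

/-- The quadratic function `x ↦ xᵀ A x + 2 bᵀ x + c`. -/
noncomputable def quadF {n : ℕ} (A : Matrix (Fin n) (Fin n) ℝ) (b : Fin n → ℝ) (c : ℝ)
    (x : Fin n → ℝ) : ℝ :=
  x ⬝ᵥ (A *ᵥ x) + 2 * (b ⬝ᵥ x) + c

/-- Euclidean norm of a vector in `ℝⁿ`. -/
noncomputable def eNorm {n : ℕ} (x : Fin n → ℝ) : ℝ :=
  Real.sqrt (x ⬝ᵥ x)

/-- Spectral (ℓ²-operator) norm of a matrix. -/
noncomputable def sNorm {n : ℕ} (A : Matrix (Fin n) (Fin n) ℝ) : ℝ :=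
  ‖Matrix.toEuclideanCLM (𝕜 := ℝ) A‖

/-- `x(γ) = −A(γ)⁻¹ b(γ)`. -/
noncomputable def xOf {n : ℕ} (A₀ A₁ : Matrix (Fin n) (Fin n) ℝ) (b₀ b₁ : Fin n → ℝ)
    (γ : ℝ) : Fin n → ℝ :=
  -((A₀ + γ • A₁)⁻¹ *ᵥ (b₀ + γ • b₁))

/-- `ν(γ) = q₁(x(γ))`. -/
noncomputable def nuF {n : ℕ} (A₀ A₁ : Matrix (Fin n) (Fin n) ℝ) (b₀ b₁ : Fin n → ℝ)
    (c₁ : ℝ) (γ : ℝ) : ℝ :=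
  quadF A₁ b₁ c₁ (xOf A₀ A₁ b₀ b₁ γ)

lemma eNorm_sq {n : ℕ} (x : Fin n → ℝ) : eNorm x ^ 2 = x ⬝ᵥ x :=
  Real.sq_sqrt (by simpa using dotProduct_star_self_nonneg x)

lemma eNorm_eq_norm {n : ℕ} (x : Fin n → ℝ) : eNorm x = ‖WithLp.toLp 2 x‖ := by
  simp [eNorm, EuclideanSpace.norm_eq, dotProduct, sq]

lemma eNorm_mulVec_le {n : ℕ} (A : Matrix (Fin n) (Fin n) ℝ) (v : Fin n → ℝ) :
    eNorm (A *ᵥ v) ≤ sNorm A * eNorm v := by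
  simpa [eNorm_eq_norm, sNorm, Matrix.toEuclideanCLM_toLp] using
    (Matrix.toEuclideanCLM (𝕜 := ℝ) A).le_opNorm (WithLp.toLp 2 v)

lemma sNorm_add_smul_le {n : ℕ} (A B : Matrix (Fin n) (Fin n) ℝ) {γ : ℝ} (hγ : 0 ≤ γ) :
    sNorm (A + γ • B) ≤ sNorm A + γ * sNorm B := by
  unfold sNorm
  rw [map_add, map_smul]
  refine (norm_add_le _ _).trans ?_
  rw [norm_smul, Real.norm_of_nonneg hγ]

lemma mulVec_dotProduct_self_le {n : ℕ} {A : Matrix (Fin n) (Fin n) ℝ} {L : ℝ}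
    (hA : sNorm A ≤ L) (v : Fin n → ℝ) :
    (A *ᵥ v) ⬝ᵥ (A *ᵥ v) ≤ L ^ 2 * (v ⬝ᵥ v) := by
  rw [← eNorm_sq, ← eNorm_sq, ← mul_pow]
  exact pow_le_pow_left₀ (Real.sqrt_nonneg _)
    ((eNorm_mulVec_le A v).trans (mul_le_mul_of_nonneg_right hA (Real.sqrt_nonneg _))) 2

lemma dotProduct_self_nonneg_real {n : ℕ} (v : Fin n → ℝ) : 0 ≤ v ⬝ᵥ v := by
  rw [← eNorm_sq]; positivity

lemma Matrix.IsSymm.dotProduct_mulVec_comm {n : ℕ} {A : Matrix (Fin n) (Fin n) ℝ}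
    (hA : A.IsSymm) (u v : Fin n → ℝ) : u ⬝ᵥ (A *ᵥ v) = v ⬝ᵥ (A *ᵥ u) := by
  rw [dotProduct_mulVec, ← mulVec_transpose, hA.eq, dotProduct_comm]

/-- A positive semidefinite `A` with `‖A‖ ≤ L` satisfies `|A u|² ≤ L uᵀ A u`. -/
lemma Matrix.PosSemidef.mulVec_dotProduct_self_le {n : ℕ} {A : Matrix (Fin n) (Fin n) ℝ}
    (hA : A.PosSemidef) (hs : A.IsSymm) {L : ℝ} (hL : 0 < L) (hAL : sNorm A ≤ L)
    (u : Fin n → ℝ) : (A *ᵥ u) ⬝ᵥ (A *ᵥ u) ≤ L * (u ⬝ᵥ (A *ᵥ u)) := by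
  set p := A *ᵥ u with hp
  have h1 : 0 ≤ (L • u - p) ⬝ᵥ (A *ᵥ (L • u - p)) := by
    simpa using hA.dotProduct_mulVec_nonneg (L • u - p)
  have h2 := _root_.mulVec_dotProduct_self_le hAL p
  have h3 := dotProduct_self_nonneg_real (L • p - A *ᵥ p)
  have h4 : u ⬝ᵥ (A *ᵥ p) = p ⬝ᵥ p := hs.dotProduct_mulVec_comm u p
  simp only [mulVec_sub, mulVec_smul, sub_dotProduct, dotProduct_sub, smul_dotProduct,
    dotProduct_smul, smul_eq_mul, ← hp, h4, dotProduct_comm (A *ᵥ p) p] at h1 h3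
  have h5 : L * (p ⬝ᵥ (A *ᵥ p)) ≤ L * (L * (p ⬝ᵥ p)) := by nlinarith
  have h6 := le_of_mul_le_mul_left h5 hL
  refine le_of_mul_le_mul_left ?_ hL
  nlinarith

lemma dotProduct_self_le_of_smul_le {n : ℕ} {A : Matrix (Fin n) (Fin n) ℝ} {ξ : ℝ}
    (hξ : 0 ≤ ξ) (hA : (A - ξ • (1 : Matrix (Fin n) (Fin n) ℝ)).PosSemidef) (u : Fin n → ℝ) :
    ξ ^ 2 * (u ⬝ᵥ u) ≤ (A *ᵥ u) ⬝ᵥ (A *ᵥ u) := by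
  have h1 : 0 ≤ u ⬝ᵥ ((A - ξ • (1 : Matrix (Fin n) (Fin n) ℝ)) *ᵥ u) := by
    simpa using hA.dotProduct_mulVec_nonneg u
  have h2 := dotProduct_self_nonneg_real (A *ᵥ u - ξ • u)
  simp only [sub_mulVec, smul_mulVec, one_mulVec, sub_dotProduct, dotProduct_sub,
    smul_dotProduct, dotProduct_smul, smul_eq_mul, dotProduct_comm (A *ᵥ u) u] at h1 h2
  nlinarith [mul_nonneg hξ h1]

lemma posDef_of_mem_interior {n : ℕ} {A₀ A₁ : Matrix (Fin n) (Fin n) ℝ} {γbar : ℝ}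
    (hbar : (A₀ + γbar • A₁).PosDef) {γ : ℝ}
    (hγ : γ ∈ interior {γ : ℝ | 0 ≤ γ ∧ (A₀ + γ • A₁).PosSemidef}) :
    (A₀ + γ • A₁).PosDef := by
  obtain ⟨r, hr, hball⟩ := Metric.mem_nhds_iff.1 (mem_interior_iff_mem_nhds.1 hγ)
  have key : ∀ t, |t| < r → ∀ v : Fin n → ℝ,
      0 ≤ v ⬝ᵥ (A₀ *ᵥ v) + (γ + t) * (v ⬝ᵥ (A₁ *ᵥ v)) := by
    intro t ht v
    have := (hball (show γ + t ∈ Metric.ball γ r by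
      simpa [Metric.mem_ball, Real.dist_eq] using ht)).2.dotProduct_mulVec_nonneg v
    simpa [add_mulVec, smul_mulVec, dotProduct_add, dotProduct_smul] using this
  refine Matrix.PosDef.of_dotProduct_mulVec_pos (interior_subset hγ).2.1 fun v hv => ?_
  have hb : 0 < v ⬝ᵥ (A₀ *ᵥ v) + γbar * (v ⬝ᵥ (A₁ *ᵥ v)) := by
    simpa [add_mulVec, smul_mulVec, dotProduct_add, dotProduct_smul] using
      hbar.dotProduct_mulVec_pos hv
  have h0 := key 0 (by simpa using hr) v
  have h1 := key (r / 2) (by rw [abs_of_pos] <;> linarith) v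
  have h2 := key (-(r / 2)) (by rw [abs_neg, abs_of_pos] <;> linarith) v
  suffices h : 0 < v ⬝ᵥ (A₀ *ᵥ v) + γ * (v ⬝ᵥ (A₁ *ᵥ v)) by
    simpa [add_mulVec, smul_mulVec, dotProduct_add, dotProduct_smul] using h
  by_contra hneg
  have h3 : v ⬝ᵥ (A₁ *ᵥ v) = 0 := by
    have h5 : r / 2 * (v ⬝ᵥ (A₁ *ᵥ v)) = 0 := by linarith
    exact (mul_eq_zero.1 h5).resolve_left (by positivity)
  simp only [h3, mul_zero, add_zero] at hb hneg
  exact hneg hb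

lemma isUnit_det_of_posDef {n : ℕ} {A : Matrix (Fin n) (Fin n) ℝ} (hA : A.PosDef) :
    IsUnit A.det := hA.det_pos.ne'.isUnit

lemma mulVec_xOf {n : ℕ} {A₀ A₁ : Matrix (Fin n) (Fin n) ℝ} {b₀ b₁ : Fin n → ℝ} {γ : ℝ}
    (h : IsUnit (A₀ + γ • A₁).det) :
    (A₀ + γ • A₁) *ᵥ xOf A₀ A₁ b₀ b₁ γ = -(b₀ + γ • b₁) := by
  rw [xOf, mulVec_neg, mulVec_mulVec, Matrix.mul_nonsing_inv _ h, one_mulVec]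

lemma xOf_eq_sub {n : ℕ} {A₀ A₁ : Matrix (Fin n) (Fin n) ℝ} {b₀ b₁ : Fin n → ℝ} {γ s : ℝ}
    (h : IsUnit (A₀ + γ • A₁).det) (hs : IsUnit (A₀ + s • A₁).det) :
    xOf A₀ A₁ b₀ b₁ s = xOf A₀ A₁ b₀ b₁ γ -
      (s - γ) • ((A₀ + s • A₁)⁻¹ *ᵥ (A₁ *ᵥ xOf A₀ A₁ b₀ b₁ γ + b₁)) := by
  have hx := mulVec_xOf (b₀ := b₀) (b₁ := b₁) h
  set x := xOf A₀ A₁ b₀ b₁ γ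
  have e : (s - γ) • (A₁ *ᵥ x + b₁) = (A₀ + s • A₁) *ᵥ x + (b₀ + s • b₁) := by
    have hb : b₀ = -(A₀ *ᵥ x + γ • (A₁ *ᵥ x)) - γ • b₁ := by
      rw [add_mulVec, smul_mulVec] at hx
      rw [hx]; module
    rw [hb, add_mulVec, smul_mulVec]; module
  rw [← mulVec_smul, e, mulVec_add, mulVec_mulVec, Matrix.nonsing_inv_mul _ hs, one_mulVec, xOf]
  module

lemma quadF_sub_smul {n : ℕ} {A : Matrix (Fin n) (Fin n) ℝ} (hA : A.IsSymm)
    (b : Fin n → ℝ) (c t : ℝ) (x g : Fin n → ℝ) :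
    quadF A b c (x - t • g) =
      quadF A b c x + t * (-2 * ((A *ᵥ x + b) ⬝ᵥ g) + t * (g ⬝ᵥ (A *ᵥ g))) := by
  simp only [quadF, mulVec_sub, mulVec_smul, sub_dotProduct, dotProduct_sub, smul_dotProduct,
    dotProduct_smul, smul_eq_mul, add_dotProduct, hA.dotProduct_mulVec_comm x g,
    dotProduct_comm (A *ᵥ x) g]
  ring

lemma continuousAt_affine_inv {n : ℕ} {A₀ A₁ : Matrix (Fin n) (Fin n) ℝ} {γ : ℝ}
    (h : IsUnit (A₀ + γ • A₁).det) :
    ContinuousAt (fun s : ℝ => (A₀ + s • A₁)⁻¹) γ := by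
  have hc : Continuous fun s : ℝ => A₀ + s • A₁ := by fun_prop
  simp only [Matrix.inv_def, Ring.inverse_eq_inv']
  exact (hc.matrix_det.continuousAt.inv₀ h.ne_zero).smul hc.matrix_adjugate.continuousAt

lemma hasDerivAt_nuF {n : ℕ} {A₀ A₁ : Matrix (Fin n) (Fin n) ℝ} (hA₁ : A₁.IsSymm)
    (b₀ b₁ : Fin n → ℝ) (c₁ : ℝ) {γ : ℝ} (h : IsUnit (A₀ + γ • A₁).det) :
    HasDerivAt (nuF A₀ A₁ b₀ b₁ c₁)
      (-2 * ((A₁ *ᵥ xOf A₀ A₁ b₀ b₁ γ + b₁) ⬝ᵥ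
        ((A₀ + γ • A₁)⁻¹ *ᵥ (A₁ *ᵥ xOf A₀ A₁ b₀ b₁ γ + b₁)))) γ := by
  set w := A₁ *ᵥ xOf A₀ A₁ b₀ b₁ γ + b₁ with hw
  set g : ℝ → Fin n → ℝ := fun s => (A₀ + s • A₁)⁻¹ *ᵥ w with hg
  have hgc : ContinuousAt g γ :=
    ContinuousAt.comp (g := fun M : Matrix (Fin n) (Fin n) ℝ => M *ᵥ w)
      (by fun_prop) (continuousAt_affine_inv h)
  set k : ℝ → ℝ := fun s => -2 * (w ⬝ᵥ g s) + (s - γ) * (g s ⬝ᵥ (A₁ *ᵥ g s)) with hk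
  have hkc : ContinuousAt k γ := by
    have h1 : Continuous fun p : ℝ × (Fin n → ℝ) =>
        -2 * (w ⬝ᵥ p.2) + (p.1 - γ) * (p.2 ⬝ᵥ (A₁ *ᵥ p.2)) := by fun_prop
    exact ContinuousAt.comp (f := fun s => (s, g s)) h1.continuousAt
      (continuousAt_id.prodMk hgc)
  have hev : ∀ᶠ s in nhds γ, IsUnit (A₀ + s • A₁).det := by
    have hc : Continuous fun s : ℝ => (A₀ + s • A₁).det :=
      Continuous.matrix_det (by fun_prop)
    filter_upwards [hc.continuousAt.eventually_ne h.ne_zero] with s hs using hs.isUnit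
  rw [show -2 * (w ⬝ᵥ ((A₀ + γ • A₁)⁻¹ *ᵥ w)) = k γ by simp [hk, hg]]
  rw [hasDerivAt_iff_tendsto_slope]
  refine (hkc.tendsto.mono_left nhdsWithin_le_nhds).congr' ?_
  filter_upwards [nhdsWithin_le_nhds hev, self_mem_nhdsWithin] with s hs hne
  have hne' : s - γ ≠ 0 := sub_ne_zero.2 hne
  rw [slope_def_field, nuF, nuF, xOf_eq_sub h hs, quadF_sub_smul hA₁, add_sub_cancel_left,
    mul_div_cancel_left₀ _ hne']

/-- `A₀ Â⁻¹ b₁ - A₁ Â⁻¹ b₀ = A(γ) Â⁻¹ (A₁ x(γ) + b₁)` where `Â = A(γ̂)`. -/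
lemma coherence_eq {n : ℕ} {A₀ A₁ : Matrix (Fin n) (Fin n) ℝ} {b₀ b₁ : Fin n → ℝ} {γ γhat : ℝ}
    (h : IsUnit (A₀ + γ • A₁).det) (hhat : IsUnit (A₀ + γhat • A₁).det) :
    A₀ *ᵥ ((A₀ + γhat • A₁)⁻¹ *ᵥ b₁) - A₁ *ᵥ ((A₀ + γhat • A₁)⁻¹ *ᵥ b₀) =
      (A₀ + γ • A₁) *ᵥ ((A₀ + γhat • A₁)⁻¹ *ᵥ (A₁ *ᵥ xOf A₀ A₁ b₀ b₁ γ + b₁)) := by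
  have hx := mulVec_xOf (b₀ := b₀) (b₁ := b₁) h
  set x := xOf A₀ A₁ b₀ b₁ γ
  set B := (A₀ + γhat • A₁)⁻¹ with hB
  have hb : b₀ = -(A₀ *ᵥ x) - γ • (A₁ *ᵥ x + b₁) := by
    rw [add_mulVec, smul_mulVec] at hx
    rw [show A₀ *ᵥ x = -(b₀ + γ • b₁) - γ • (A₁ *ᵥ x) by rw [← hx]; module]; module
  have hcomm : A₀ * B * A₁ = A₁ * B * A₀ := by
    have h1 : (A₀ + γhat • A₁) * B = 1 := Matrix.mul_nonsing_inv _ hhat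
    have h2 : B * (A₀ + γhat • A₁) = 1 := Matrix.nonsing_inv_mul _ hhat
    have h3 : A₀ * B = 1 - γhat • (A₁ * B) := by
      rw [← h1, add_mul, smul_mul_assoc]; abel
    have h4 : B * A₀ = 1 - γhat • (B * A₁) := by
      rw [← h2, mul_add, mul_smul_comm]; abel
    rw [h3, mul_assoc A₁ B A₀, h4, sub_mul, mul_sub, smul_mul_assoc, mul_smul_comm, one_mul,
      mul_one, mul_assoc]
  have hcx : A₀ *ᵥ (B *ᵥ (A₁ *ᵥ x)) = A₁ *ᵥ (B *ᵥ (A₀ *ᵥ x)) := by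
    simp only [mulVec_mulVec, ← mul_assoc, hcomm]
  rw [hb]
  simp only [mulVec_sub, mulVec_neg, mulVec_smul, mulVec_add, add_mulVec, smul_mulVec, hcx]
  module

lemma exists_Icc_superset_of_sub_le {S : Set ℝ} {C : ℝ} (hC : 0 ≤ C)
    (h : ∀ x ∈ S, ∀ y ∈ S, y - x ≤ C) : ∃ a b : ℝ, b - a ≤ C ∧ S ⊆ Set.Icc a b := by
  rcases S.eq_empty_or_nonempty with rfl | hne
  · exact ⟨0, 0, by simpa using hC, Set.empty_subset _⟩
  obtain ⟨z, hz⟩ := hne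
  have hbelow : BddBelow S := ⟨z - C, fun x hx => by linarith [h x hx z hz]⟩
  refine ⟨sInf S, sInf S + C, by simp, fun y hy => ⟨csInf_le hbelow hy, ?_⟩⟩
  have : y - C ≤ sInf S := le_csInf ⟨z, hz⟩ fun x hx => by linarith [h x hx y hy]
  linarith

lemma convex_setOf_posSemidef {n : ℕ} (A₀ A₁ : Matrix (Fin n) (Fin n) ℝ) :
    Convex ℝ {γ : ℝ | 0 ≤ γ ∧ (A₀ + γ • A₁).PosSemidef} := by
  rintro s ⟨hs0, hs⟩ t ⟨ht0, ht⟩ a b ha hb hab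
  refine ⟨by simp only [smul_eq_mul]; positivity, ?_⟩
  have e : A₀ + (a • s + b • t) • A₁ = a • (A₀ + s • A₁) + b • (A₀ + t • A₁) := by
    have : A₀ = (a + b) • A₀ := by rw [hab, one_smul]
    nth_rewrite 1 [this]
    simp only [smul_eq_mul]; module
  rw [e]
  exact (hs.smul ha).add (ht.smul hb)

/-- If the coherence parameter `δ` is positive, then
`ν'(γ) ≤ −δ²ξ²/(4ζ³)` on the interior of `Γ`, and for every `ε > 0` the set
`{γ ∈ int Γ : |ν(γ)| ≤ ε/(2ζ)}` is contained in an interval of length at most `4εζ²/(δ²ξ²)`. -/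
theorem stmt_14 {n : ℕ} (hn : 0 < n)
    (A₀ A₁ : Matrix (Fin n) (Fin n) ℝ) (hA₀ : A₀.IsSymm) (hA₁ : A₁.IsSymm)
    (b₀ b₁ : Fin n → ℝ) (c₀ c₁ : ℝ)
    (xbar : Fin n → ℝ) (hxbar : quadF A₁ b₁ c₁ xbar < 0)
    (γbar : ℝ) (hγbar : 0 ≤ γbar) (hpdbar : (A₀ + γbar • A₁).PosDef)
    (hA₀n : sNorm A₀ ≤ 1) (hA₁n : sNorm A₁ ≤ 1)
    (hb₀n : eNorm b₀ ≤ 1) (hb₁n : eNorm b₁ ≤ 1)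
    (ξ ζ : ℝ) (hξ0 : 0 < ξ) (hξ1 : ξ ≤ 1) (hζ : 1 ≤ ζ)
    (hΓ : {γ : ℝ | 0 ≤ γ ∧ (A₀ + γ • A₁).PosSemidef} ⊆ Set.Icc 0 ζ)
    (γhat : ℝ) (hγhat : 0 ≤ γhat)
    (hAγhat : ((A₀ + γhat • A₁) - ξ • (1 : Matrix (Fin n) (Fin n) ℝ)).PosSemidef)
    (δ : ℝ)
    (hδ : δ = eNorm (A₀ *ᵥ ((A₀ + γhat • A₁)⁻¹ *ᵥ b₁) -
      A₁ *ᵥ ((A₀ + γhat • A₁)⁻¹ *ᵥ b₀)))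
    (hδpos : 0 < δ) :
    (∀ γ ∈ interior {γ : ℝ | 0 ≤ γ ∧ (A₀ + γ • A₁).PosSemidef},
      deriv (nuF A₀ A₁ b₀ b₁ c₁) γ ≤ -(δ ^ 2 * ξ ^ 2 / (4 * ζ ^ 3))) ∧
    (∀ ε : ℝ, 0 < ε → ∃ a b : ℝ, b - a ≤ 4 * ε * ζ ^ 2 / (δ ^ 2 * ξ ^ 2) ∧
      {γ ∈ interior {γ : ℝ | 0 ≤ γ ∧ (A₀ + γ • A₁).PosSemidef} |
        |nuF A₀ A₁ b₀ b₁ c₁ γ| ≤ ε / (2 * ζ)} ⊆ Set.Icc a b) := by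
  have hderiv : ∀ γ ∈ interior {γ : ℝ | 0 ≤ γ ∧ (A₀ + γ • A₁).PosSemidef},
      deriv (nuF A₀ A₁ b₀ b₁ c₁) γ ≤ -(δ ^ 2 * ξ ^ 2 / (4 * ζ ^ 3)) := by
    intro γ hγ
    have hpd := posDef_of_mem_interior hpdbar hγ
    have hu := isUnit_det_of_posDef hpd
    have hhatu : IsUnit (A₀ + γhat • A₁).det := by
      refine isUnit_det_of_posDef ?_
      have := Matrix.PosDef.posSemidef_add hAγhat (Matrix.PosDef.one.smul hξ0)
      rwa [sub_add_cancel] at this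
    have hγI := hΓ (interior_subset hγ)
    have hsymm : (A₀ + γ • A₁).IsSymm := hA₀.add (hA₁.smul γ)
    have hnorm : sNorm (A₀ + γ • A₁) ≤ 2 * ζ :=
      (sNorm_add_smul_le A₀ A₁ hγI.1).trans (by nlinarith [hγI.1, hγI.2])
    rw [(hasDerivAt_nuF hA₁ b₀ b₁ c₁ hu).deriv]
    set w := A₁ *ᵥ xOf A₀ A₁ b₀ b₁ γ + b₁ with hw
    have h1 := hpd.posSemidef.mulVec_dotProduct_self_le hsymm (by linarith) hnorm
      ((A₀ + γ • A₁)⁻¹ *ᵥ w)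
    rw [mulVec_mulVec, Matrix.mul_nonsing_inv _ hu, one_mulVec, dotProduct_comm (_ *ᵥ _) w] at h1
    have h2 := dotProduct_self_le_of_smul_le hξ0.le hAγhat ((A₀ + γhat • A₁)⁻¹ *ᵥ w)
    rw [mulVec_mulVec, Matrix.mul_nonsing_inv _ hhatu, one_mulVec] at h2
    have h3 := mulVec_dotProduct_self_le hnorm ((A₀ + γhat • A₁)⁻¹ *ᵥ w)
    rw [hw, ← coherence_eq hu hhatu, ← hw, ← eNorm_sq, ← hδ] at h3
    set P := w ⬝ᵥ ((A₀ + γ • A₁)⁻¹ *ᵥ w)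
    set U := ((A₀ + γhat • A₁)⁻¹ *ᵥ w) ⬝ᵥ ((A₀ + γhat • A₁)⁻¹ *ᵥ w)
    have hζ0 : 0 < ζ := by linarith
    have h4 : δ ^ 2 * ξ ^ 2 ≤ (2 * ζ) ^ 2 * (2 * ζ * P) :=
      calc δ ^ 2 * ξ ^ 2 ≤ (2 * ζ) ^ 2 * U * ξ ^ 2 := by gcongr
        _ = (2 * ζ) ^ 2 * (ξ ^ 2 * U) := by ring
        _ ≤ (2 * ζ) ^ 2 * (2 * ζ * P) := mul_le_mul_of_nonneg_left (h2.trans h1) (sq_nonneg _)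
    have h5 : δ ^ 2 * ξ ^ 2 / (4 * ζ ^ 3) ≤ 2 * P := by
      rw [div_le_iff₀ (by positivity)]
      linarith
    linarith
  refine ⟨hderiv, fun ε hε => exists_Icc_superset_of_sub_le (by positivity) ?_⟩
  rintro s ⟨hs, hsν⟩ t ⟨ht, htν⟩
  have hζ0 : 0 < ζ := by linarith
  rcases le_total t s with hts | hst
  · have : 0 ≤ 4 * ε * ζ ^ 2 / (δ ^ 2 * ξ ^ 2) := by positivity
    linarith
  have hdiff : ∀ γ ∈ interior {γ : ℝ | 0 ≤ γ ∧ (A₀ + γ • A₁).PosSemidef},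
      DifferentiableAt ℝ (nuF A₀ A₁ b₀ b₁ c₁) γ := fun γ hγ =>
    (hasDerivAt_nuF hA₁ b₀ b₁ c₁
      (isUnit_det_of_posDef (posDef_of_mem_interior hpdbar hγ))).differentiableAt
  have hmvt := (convex_setOf_posSemidef A₀ A₁).interior.image_sub_le_mul_sub_of_deriv_le
    (fun γ hγ => (hdiff γ hγ).continuousAt.continuousWithinAt)
    (fun γ hγ => (hdiff γ (interior_subset hγ)).differentiableWithinAt)
    (fun γ hγ => hderiv γ (interior_subset hγ)) s hs t ht hst
  have h1 := (abs_le.1 hsν).2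
  have h2 := (abs_le.1 htν).1
  have h3 : δ ^ 2 * ξ ^ 2 / (4 * ζ ^ 3) * (t - s) ≤ ε / ζ := by
    have : ε / ζ = ε / (2 * ζ) + ε / (2 * ζ) := by field_simp; norm_num
    linarith
  rw [le_div_iff₀ (by positivity)]
  calc (t - s) * (δ ^ 2 * ξ ^ 2)
      = δ ^ 2 * ξ ^ 2 / (4 * ζ ^ 3) * (t - s) * (4 * ζ ^ 3) := by field_simp
    _ ≤ ε / ζ * (4 * ζ ^ 3) := by gcongr
    _ = 4 * ε * ζ ^ 2 := by field_simp
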